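/- Let p > 1, 1/p + 1/q = 1, σ > 1, and let f, g : (0,∞) → [0,∞) be measurable with 0 < ‖f‖₁ := ∫₀^∞ f < ∞, 0 < ‖g‖₁ := ∫₀^∞ g < ∞, 0 < ‖f‖_{p,φ} := (∫₀^∞ x^{p(1−σ)−1} f(x)^p dx)^{1/p} < ∞ and 0 < ‖g‖_{q,ψ} := (∫₀^∞ y^{q(1+σ)−1} g(y)^q dy)^{1/q} < ∞. Then ∫₀^∞∫₀^∞ coth(x/y) f(x) g(y) dx dy < ‖f‖₁‖g‖₁ + (Γ(σ)/2^{σ−1}) ζ(σ) ‖f‖_{p,φ} ‖g‖_{q,ψ}. -/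

import Mathlib

open MeasureTheory Real Set

noncomputable def cothR (v : ℝ) : ℝ := (Real.exp v + Real.exp (-v)) / (Real.exp v - Real.exp (-v))
noncomputable def zetaR (σ : ℝ) : ℝ := ∑' k : ℕ+, (k : ℝ) ^ (-σ)

theorem integrableOn_and_integral_comp_div_mul_inv {h : ℝ → ℝ}
    (hh : IntegrableOn (fun v => h v * v⁻¹) (Ioi 0)) {y : ℝ} (hy : 0 < y) :
    IntegrableOn (fun x => h (x / y) * x⁻¹) (Ioi 0) ∧
      ∫ x in Ioi (0 : ℝ), h (x / y) * x⁻¹ = ∫ v in Ioi (0 : ℝ), h v * v⁻¹ := by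
  have hy' : 0 < y⁻¹ := inv_pos.mpr hy
  have key : (fun x => h (x / y) * x⁻¹) = fun x => y⁻¹ * (h (y⁻¹ * x) * (y⁻¹ * x)⁻¹) := by
    funext x
    rw [div_eq_inv_mul, mul_inv, inv_inv]
    field_simp
  rw [key]
  constructor
  · refine Integrable.const_mul ?_ _
    refine (integrableOn_Ioi_comp_mul_left_iff (fun v => h v * v⁻¹) 0 hy').mpr ?_
    rwa [mul_zero]
  · rw [integral_const_mul, integral_comp_mul_left_Ioi (fun v => h v * v⁻¹) 0 hy', mul_zero,
      smul_eq_mul, inv_inv, ← mul_assoc, inv_mul_cancel₀ hy.ne', one_mul]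

theorem integrableOn_and_integral_comp_inv_mul_inv {h : ℝ → ℝ}
    (hh : IntegrableOn (fun v => h v * v⁻¹) (Ioi 0)) :
    IntegrableOn (fun v => h v⁻¹ * v⁻¹) (Ioi 0) ∧
      ∫ v in Ioi (0 : ℝ), h v⁻¹ * v⁻¹ = ∫ v in Ioi (0 : ℝ), h v * v⁻¹ := by
  have key : EqOn (fun x : ℝ => (|(-1 : ℝ)| * x ^ ((-1 : ℝ) - 1)) •
      (h (x ^ (-1 : ℝ)) * (x ^ (-1 : ℝ))⁻¹)) (fun v => h v⁻¹ * v⁻¹) (Ioi 0) := by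
    intro x hx
    have hx : 0 < x := hx
    have h2 : x ^ ((-1 : ℝ) - 1) = x⁻¹ * x⁻¹ := by
      rw [sub_eq_add_neg, rpow_add hx, rpow_neg_one]
    simp only [h2, rpow_neg_one, abs_neg, abs_one, one_mul, inv_inv, smul_eq_mul]
    field_simp
  constructor
  · exact ((integrableOn_Ioi_comp_rpow_iff (fun v => h v * v⁻¹)
      (by norm_num : (-1 : ℝ) ≠ 0)).mpr hh).congr_fun key measurableSet_Ioi
  · rw [← integral_comp_rpow_Ioi (fun v => h v * v⁻¹) (by norm_num : (-1 : ℝ) ≠ 0)]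
    exact (setIntegral_congr_fun measurableSet_Ioi key).symm

theorem integrable_and_integral_prod_mul {α β : Type*} [MeasurableSpace α] [MeasurableSpace β]
    {μ : Measure α} {ν : Measure β} [SFinite μ] [SFinite ν] {N : α → β → ℝ} {Φ : β → ℝ} {C : ℝ}
    (hN : Measurable (Function.uncurry N)) (hΦ : Integrable Φ ν) (hΦm : Measurable Φ)
    (hN0 : ∀ᵐ x ∂ν, ∀ᵐ y ∂μ, 0 ≤ N y x)
    (hNi : ∀ᵐ x ∂ν, Integrable (fun y => N y x) μ ∧ ∫ y, N y x ∂μ = C) :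
    Integrable (fun z : α × β => N z.1 z.2 * Φ z.2) (μ.prod ν) ∧
      ∫ z, N z.1 z.2 * Φ z.2 ∂(μ.prod ν) = C * ∫ x, Φ x ∂ν := by
  have hm : Measurable (fun z : α × β => N z.1 z.2 * Φ z.2) :=
    hN.mul (hΦm.comp measurable_snd)
  have hI : Integrable (fun z : α × β => N z.1 z.2 * Φ z.2) (μ.prod ν) := by
    rw [integrable_prod_iff' hm.aestronglyMeasurable]
    refine ⟨hNi.mono fun x hx => hx.1.mul_const (Φ x), ?_⟩
    refine (hΦ.norm.const_mul C).congr ?_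
    filter_upwards [hN0, hNi] with x h0 hx
    rw [← hx.2, ← integral_mul_const]
    refine integral_congr_ae (h0.mono fun y hy => ?_)
    simp [abs_of_nonneg hy]
  refine ⟨hI, ?_⟩
  rw [integral_prod_symm _ hI, ← integral_const_mul]
  refine integral_congr_ae (hNi.mono fun x hx => ?_)
  simp only [integral_mul_const, hx.2]

theorem rpow_young_kernel {k a b x y σ p q : ℝ} (hpq : p.HolderConjugate q) (hk : 0 ≤ k)
    (ha : 0 ≤ a) (hb : 0 ≤ b) (hx : 0 < x) (hy : 0 < y) :
    (k * (x / y) ^ σ * y⁻¹ * (x ^ (p * (1 - σ) - 1) * a ^ p)) ^ (1 / p) *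
      (k * (x / y) ^ σ * x⁻¹ * (y ^ (q * (1 + σ) - 1) * b ^ q)) ^ (1 / q) = k * a * b := by
  have hp := hpq.pos
  have hq := hpq.symm.pos
  rcases hk.eq_or_lt with rfl | hk
  · simp [hp.ne', zero_rpow]
  rcases ha.eq_or_lt with rfl | ha
  · simp [hp.ne', zero_rpow]
  rcases hb.eq_or_lt with rfl | hb
  · simp [hq.ne', zero_rpow]
  rw [← exp_log hk, ← exp_log ha, ← exp_log hb, ← exp_log hx, ← exp_log hy]
  generalize log k = k'
  generalize log a = a'
  generalize log b = b'
  generalize log x = x'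
  generalize log y = y'
  simp only [← exp_sub, ← exp_neg, ← exp_mul, ← exp_add]
  simp only [one_div]
  congr 1
  have e1 : p * p⁻¹ = 1 := mul_inv_cancel₀ hp.ne'
  have e2 : q * q⁻¹ = 1 := mul_inv_cancel₀ hq.ne'
  linear_combination (k' + (x' - y') * σ - x' - y') * hpq.inv_add_inv_eq_one +
    (x' * (1 - σ) + a') * e1 + (y' * (1 + σ) + b') * e2

theorem integral_hilbert_kernel_lt {k f g : ℝ → ℝ} {p q σ : ℝ} (hpq : p.HolderConjugate q)
    (hk : Measurable k) (hk0 : ∀ v, 0 < v → 0 < k v)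
    (hki : IntegrableOn (fun v => k v * v ^ σ * v⁻¹) (Ioi 0))
    (hf : Measurable f) (hg : Measurable g) (hf0 : ∀ x, 0 ≤ f x) (hg0 : ∀ y, 0 ≤ g y)
    (hfi : IntegrableOn (fun x => x ^ (p * (1 - σ) - 1) * f x ^ p) (Ioi 0))
    (hfpos : 0 < ∫ x in Ioi (0 : ℝ), x ^ (p * (1 - σ) - 1) * f x ^ p)
    (hgi : IntegrableOn (fun y => y ^ (q * (1 + σ) - 1) * g y ^ q) (Ioi 0))
    (hgpos : 0 < ∫ y in Ioi (0 : ℝ), y ^ (q * (1 + σ) - 1) * g y ^ q) :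
    Integrable (fun z : ℝ × ℝ => k (z.2 / z.1) * f z.2 * g z.1)
        ((volume.restrict (Ioi 0)).prod (volume.restrict (Ioi 0))) ∧
      ∫ z : ℝ × ℝ, k (z.2 / z.1) * f z.2 * g z.1
          ∂((volume.restrict (Ioi 0)).prod (volume.restrict (Ioi 0))) <
        (∫ v in Ioi (0 : ℝ), k v * v ^ σ * v⁻¹) *
          ((∫ x in Ioi (0 : ℝ), x ^ (p * (1 - σ) - 1) * f x ^ p) ^ (1 / p) *
            (∫ y in Ioi (0 : ℝ), y ^ (q * (1 + σ) - 1) * g y ^ q) ^ (1 / q)) := by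
  have hp := hpq.pos
  have hq := hpq.symm.pos
  have hsum : 1 / p + 1 / q = 1 := by simpa using hpq.inv_add_inv_eq_one
  set μ : Measure ℝ := volume.restrict (Ioi 0) with hμ
  set Φ : ℝ → ℝ := fun x => x ^ (p * (1 - σ) - 1) * f x ^ p with hΦ
  set Ψ : ℝ → ℝ := fun y => y ^ (q * (1 + σ) - 1) * g y ^ q with hΨ
  set h : ℝ → ℝ := fun v => k v * v ^ σ with hh
  set C := ∫ v in Ioi (0 : ℝ), h v * v⁻¹ with hC
  set F := ∫ x in Ioi (0 : ℝ), Φ x with hF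
  set G := ∫ y in Ioi (0 : ℝ), Ψ y with hG
  have hh0 : ∀ v, 0 < v → 0 < h v := fun v hv => mul_pos (hk0 v hv) (rpow_pos_of_pos hv σ)
  have hΦm : Measurable Φ := by fun_prop
  have hΨm : Measurable Ψ := by fun_prop
  have hhm : Measurable h := by fun_prop
  have hpos : ∀ᵐ x ∂μ, 0 < x := ae_restrict_mem measurableSet_Ioi
  have hpos2 : ∀ᵐ z ∂(μ.prod μ), 0 < z.1 ∧ 0 < z.2 := by
    rw [hμ, Measure.prod_restrict]
    exact ae_restrict_mem (measurableSet_Ioi.prod measurableSet_Ioi)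
  obtain ⟨hUi, hUC⟩ := integrable_and_integral_prod_mul (μ := μ) (ν := μ) (C := C)
    (N := fun y x => h (x / y) * y⁻¹) (by unfold Function.uncurry; fun_prop) hfi hΦm
    (hpos.mono fun x hx => hpos.mono fun y hy => by have := hh0 _ (div_pos hx hy); positivity)
    (hpos.mono fun x hx => by
      obtain ⟨h1, h2⟩ := integrableOn_and_integral_comp_inv_mul_inv hki
      obtain ⟨h3, h4⟩ := integrableOn_and_integral_comp_div_mul_inv (h := fun v => h v⁻¹) h1 hx
      simp only [inv_div] at h3 h4
      exact ⟨h3, h4.trans h2⟩)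
  obtain ⟨hWi, hWC⟩ := integrable_and_integral_prod_mul (μ := μ) (ν := μ) (C := C)
    (N := fun x y => h (x / y) * x⁻¹) (by unfold Function.uncurry; fun_prop) hgi hΨm
    (hpos.mono fun y hy => hpos.mono fun x hx => by have := hh0 _ (div_pos hx hy); positivity)
    (hpos.mono fun y hy => integrableOn_and_integral_comp_div_mul_inv hki hy)
  replace hWC := (integral_prod_swap _).trans hWC
  replace hWi := hWi.swap
  simp only [Function.comp_def, Prod.fst_swap, Prod.snd_swap] at hWi hWC
  set U : ℝ × ℝ → ℝ := fun z => h (z.2 / z.1) * z.1⁻¹ * Φ z.2 with hU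
  set W : ℝ × ℝ → ℝ := fun z => h (z.2 / z.1) * z.2⁻¹ * Ψ z.1 with hW
  set c := F ^ (1 / p) * G ^ (1 / q) with hc
  have hc0 : 0 < c := by positivity
  set S : ℝ × ℝ → ℝ := fun z => k (z.2 / z.1) * f z.2 * g z.1 with hS
  set T : ℝ × ℝ → ℝ := fun z => c * (1 / p * (U z / F) + 1 / q * (W z / G)) with hT
  have hTi : Integrable T (μ.prod μ) :=
    (((hUi.div_const F).const_mul _).add ((hWi.div_const G).const_mul _)).const_mul c
  have hTC : ∫ z, T z ∂(μ.prod μ) = C * c := by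
    rw [hT, integral_const_mul, integral_add ((hUi.div_const F).const_mul _)
      ((hWi.div_const G).const_mul _), integral_const_mul, integral_const_mul,
      integral_div, integral_div, hUC, hWC, mul_div_assoc, mul_div_assoc, div_self hfpos.ne',
      div_self hgpos.ne']
    linear_combination c * C * hsum
  have hU0 : ∀ z : ℝ × ℝ, 0 < z.1 → 0 < z.2 → 0 ≤ U z / F := fun z h1 h2 => by
    have := hh0 _ (div_pos h2 h1)
    have : 0 ≤ Φ z.2 := mul_nonneg (rpow_nonneg h2.le _) (rpow_nonneg (hf0 _) _)
    positivity
  have hW0 : ∀ z : ℝ × ℝ, 0 < z.1 → 0 < z.2 → 0 ≤ W z / G := fun z h1 h2 => by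
    have := hh0 _ (div_pos h2 h1)
    have : 0 ≤ Ψ z.1 := mul_nonneg (rpow_nonneg h1.le _) (rpow_nonneg (hg0 _) _)
    positivity
  have hST : ∀ z : ℝ × ℝ, 0 < z.1 → 0 < z.2 →
      S z = c * ((U z / F) ^ (1 / p) * (W z / G) ^ (1 / q)) := fun z h1 h2 => by
    rw [hS]
    simp only
    rw [← rpow_young_kernel (σ := σ) hpq (hk0 _ (div_pos h2 h1)).le (hf0 _) (hg0 _) h2 h1]
    change U z ^ (1 / p) * W z ^ (1 / q) = _
    nth_rewrite 1 [← div_mul_cancel₀ (U z) hfpos.ne', ← div_mul_cancel₀ (W z) hgpos.ne']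
    rw [mul_rpow (hU0 z h1 h2) hfpos.le, mul_rpow (hW0 z h1 h2) hgpos.le]
    ring
  have hle : S ≤ᵐ[μ.prod μ] T := hpos2.mono fun z ⟨h1, h2⟩ => by
    rw [hST z h1 h2]
    exact mul_le_mul_of_nonneg_left (geom_mean_le_arith_mean2_weighted (by positivity)
      (by positivity) (hU0 z h1 h2) (hW0 z h1 h2) hsum) hc0.le
  have hSm : Measurable S := by fun_prop
  have hSi : Integrable S (μ.prod μ) := by
    refine hTi.mono' hSm.aestronglyMeasurable ?_
    filter_upwards [hpos2, hle] with z ⟨h1, h2⟩ hz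
    rwa [norm_of_nonneg (mul_nonneg (mul_nonneg (hk0 _ (div_pos h2 h1)).le (hf0 _)) (hg0 _))]
  refine ⟨hSi, ?_⟩
  rw [← hTC]
  refine (integral_mono_ae hSi hTi hle).lt_of_ne fun heq => ?_
  rw [integral_eq_iff_of_ae_le hSi hTi hle] at heq
  have hUW : ∀ᵐ z ∂(μ.prod μ), U z / F = W z / G := by
    filter_upwards [hpos2, heq] with z ⟨h1, h2⟩ hz
    rw [hST z h1 h2] at hz
    exact (geom_mean_eq_arith_mean2_weighted_iff_of_pos (by positivity) (by positivity)
      (hU0 z h1 h2) (hW0 z h1 h2) hsum).mp (mul_left_cancel₀ hc0.ne' hz)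
  have : (ae μ).NeBot := by
    rw [ae_neBot, hμ, Ne, Measure.restrict_eq_zero]
    simp
  obtain ⟨y, hyU, hy⟩ := ((Measure.ae_ae_of_ae_prod hUW).and hpos).exists
  set D := F * Ψ y * y / G with hD
  have hΦD : Φ =ᵐ[μ] fun x => D * x⁻¹ := by
    filter_upwards [hyU, hpos] with x hx hx0
    have hhx := hh0 _ (div_pos hx0 hy)
    simp only [hU, hW] at hx
    rw [hD]
    field_simp at hx ⊢
    linarith
  have hD0 : D ≠ 0 := by
    intro h0
    have : F = 0 := by
      rw [hF, integral_congr_ae hΦD]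
      simp [h0]
    exact hfpos.ne' this
  have hinv : IntegrableOn (fun x : ℝ => x⁻¹) (Ioi 0) :=
    ((hfi.congr hΦD).const_mul D⁻¹).congr (.of_forall fun x => inv_mul_cancel_left₀ hD0 _)
  exact not_integrableOn_Ioi_inv hinv

theorem measurable_cothR : Measurable cothR := by
  unfold cothR
  fun_prop

theorem hasSum_cothR_sub_one {v : ℝ} (hv : 0 < v) :
    HasSum (fun n : ℕ+ => 2 * exp (-((2 * n : ℝ) * v))) (cothR v - 1) := by
  have h1 : exp (-(2 * v)) < 1 := exp_lt_one_iff.mpr (by linarith)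
  have h2 := ((hasSum_geometric_of_lt_one (exp_pos _).le h1).mul_left (exp (-(2 * v)))).mul_left 2
  have h3 := (hasSum_pnat_iff_hasSum_succ (f := fun n : ℕ => 2 * exp (-((2 * n : ℝ) * v)))
    (m := 2 * (exp (-(2 * v)) * (1 - exp (-(2 * v)))⁻¹))).mpr (by
      refine (congrArg (HasSum · _) (funext fun n => ?_)).mp h2
      rw [← exp_nat_mul, ← exp_add]
      congr 2
      push_cast
      ring)
  convert h3 using 1
  have e1 : exp (-v) = exp v * exp (-(2 * v)) := by rw [← exp_add]; congr 1; ring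
  have h4 : 1 - exp (-(2 * v)) ≠ 0 := (sub_pos.mpr h1).ne'
  rw [cothR, e1, ← mul_one_add, ← mul_one_sub, mul_div_mul_left _ _ (exp_pos v).ne']
  field_simp
  ring

theorem cothR_sub_one_pos {v : ℝ} (hv : 0 < v) : 0 < cothR v - 1 := by
  rw [← (hasSum_cothR_sub_one hv).tsum_eq]
  exact (hasSum_cothR_sub_one hv).summable.tsum_pos (fun _ => by positivity) 1 (by positivity)

theorem summable_pnat_rpow_neg {σ : ℝ} (hσ : 1 < σ) : Summable fun k : ℕ+ => (k : ℝ) ^ (-σ) :=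
  (summable_nat_rpow.mpr (by linarith : -σ < -1)).comp_injective PNat.coe_injective

theorem zetaR_pos {σ : ℝ} (hσ : 1 < σ) : 0 < zetaR σ :=
  (summable_pnat_rpow_neg hσ).tsum_pos (fun _ => by positivity) 1 (by positivity)

theorem integral_cothR_sub_one_mul_rpow {σ : ℝ} (hσ : 1 < σ) :
    ∫ v in Ioi (0 : ℝ), (cothR v - 1) * v ^ σ * v⁻¹ = Gamma σ / 2 ^ (σ - 1) * zetaR σ := by
  have hσ0 : 0 < σ := by linarith
  set E : ℕ+ → ℝ → ℝ := fun n v => 2 * (v ^ (σ - 1) * exp (-((2 * n : ℝ) * v))) with hE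
  have hEint : ∀ n, ∫ v in Ioi (0 : ℝ), E n v = Gamma σ / 2 ^ (σ - 1) * (n : ℝ) ^ (-σ) := by
    intro n
    have hn : (0 : ℝ) < n := by exact_mod_cast n.pos
    rw [hE]
    simp only
    rw [integral_const_mul, integral_rpow_mul_exp_neg_mul_Ioi hσ0 (by positivity), one_div,
      inv_rpow (by positivity), mul_rpow (by norm_num) hn.le, rpow_neg hn.le,
      rpow_sub_one (by norm_num)]
    field_simp
  have hG := Gamma_pos_of_pos hσ0
  have hEi : ∀ n, IntegrableOn (E n) (Ioi 0) := by
    intro n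
    have hn : (0 : ℝ) < n := by exact_mod_cast n.pos
    refine not_imp_comm.mp integral_undef ?_
    rw [hEint]
    positivity
  have hEnorm : ∀ n, ∫ v in Ioi (0 : ℝ), ‖E n v‖ = Gamma σ / 2 ^ (σ - 1) * (n : ℝ) ^ (-σ) := by
    intro n
    rw [← hEint n]
    refine setIntegral_congr_fun measurableSet_Ioi fun v hv => norm_of_nonneg ?_
    have hv : 0 < v := hv
    positivity
  have hsum := (summable_pnat_rpow_neg hσ).mul_left (Gamma σ / 2 ^ (σ - 1))
  have key := hasSum_integral_of_summable_integral_norm hEi (by simpa only [hEnorm] using hsum)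
  simp only [hEint] at key
  rw [zetaR, ← tsum_mul_left, key.tsum_eq]
  refine setIntegral_congr_fun measurableSet_Ioi fun v hv => ?_
  have hv : 0 < v := hv
  have := (hasSum_cothR_sub_one hv).mul_right (v ^ σ * v⁻¹)
  rw [mul_assoc, ← this.tsum_eq]
  congr 1
  funext n
  simp only [hE, rpow_sub_one hv.ne']
  ring

theorem integrableOn_cothR_sub_one_mul_rpow {σ : ℝ} (hσ : 1 < σ) :
    IntegrableOn (fun v => (cothR v - 1) * v ^ σ * v⁻¹) (Ioi 0) := by
  refine not_imp_comm.mp integral_undef ?_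
  rw [integral_cothR_sub_one_mul_rpow hσ]
  have := zetaR_pos hσ
  have := Gamma_pos_of_pos (by linarith : 0 < σ)
  positivity

theorem stmt_13 (p q σ : ℝ) (hp : 1 < p) (hpq : 1 / p + 1 / q = 1) (hσ : 1 < σ)
    (f g : ℝ → ℝ) (hf : Measurable f) (hg : Measurable g)
    (hf0 : ∀ x, 0 ≤ f x) (hg0 : ∀ y, 0 ≤ g y)
    (hf1 : IntegrableOn f (Ioi 0) volume) (hf1pos : 0 < ∫ x in Ioi (0:ℝ), f x)
    (hg1 : IntegrableOn g (Ioi 0) volume) (hg1pos : 0 < ∫ y in Ioi (0:ℝ), g y)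
    (hfi : IntegrableOn (fun x => x ^ (p * (1 - σ) - 1) * f x ^ p) (Ioi 0) volume)
    (hfpos : 0 < ∫ x in Ioi (0:ℝ), x ^ (p * (1 - σ) - 1) * f x ^ p)
    (hgi : IntegrableOn (fun y => y ^ (q * (1 + σ) - 1) * g y ^ q) (Ioi 0) volume)
    (hgpos : 0 < ∫ y in Ioi (0:ℝ), y ^ (q * (1 + σ) - 1) * g y ^ q) :
    ∫ y in Ioi (0:ℝ), ∫ x in Ioi (0:ℝ), cothR (x / y) * f x * g y <
      (∫ x in Ioi (0:ℝ), f x) * (∫ y in Ioi (0:ℝ), g y) +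
      (Real.Gamma σ / 2 ^ (σ - 1)) * zetaR σ *
        ((∫ x in Ioi (0:ℝ), x ^ (p * (1 - σ) - 1) * f x ^ p) ^ (1 / p) *
          (∫ y in Ioi (0:ℝ), y ^ (q * (1 + σ) - 1) * g y ^ q) ^ (1 / q)) := by
  have hpq' : p.HolderConjugate q := holderConjugate_iff.mpr ⟨hp, by simpa using hpq⟩
  obtain ⟨hSi, hSlt⟩ := integral_hilbert_kernel_lt (k := fun v => cothR v - 1) hpq'
    (measurable_cothR.sub_const 1) (fun v hv => cothR_sub_one_pos hv)
    (integrableOn_cothR_sub_one_mul_rpow hσ) hf hg hf0 hg0 hfi hfpos hgi hgpos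
  rw [integral_cothR_sub_one_mul_rpow hσ] at hSlt
  have hPi := hg1.mul_prod hf1
  have hP := integral_prod_mul (μ := volume.restrict (Ioi 0)) (ν := volume.restrict (Ioi 0)) g f
  have hsplit : (fun z : ℝ × ℝ => cothR (z.2 / z.1) * f z.2 * g z.1) =
      fun z => g z.1 * f z.2 + (cothR (z.2 / z.1) - 1) * f z.2 * g z.1 := by
    funext z
    ring
  have hcoth := hPi.add hSi
  rw [integral_integral (f := fun y x => cothR (x / y) * f x * g y) (by
    simpa only [Function.uncurry_def, hsplit] using! hcoth), hsplit, integral_add hPi hSi, hP,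
    mul_comm (∫ y in Ioi (0 : ℝ), g y)]
  exact add_lt_add_right hSlt _
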